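/- arXiv:0712.0379 — 3 statements merged into one kernel-verified Lean document; each statement's English description precedes it below -/
import Mathlib

section
/- Let m ≥ 1 be an integer and let L_m ∈ ℝ[X] be the Lagrange interpolation polynomial of degree ≤ m−1 through the points (i(i−2m)/(2(2m+1)), C(i,2m+1)) for i = 2m+1,…,3m. Then for every integer i with 0 ≤ i ≤ m, L_m( i(i−2m)/(2(2m+1)) ) ≠ 0. -/
open Polynomial Finset

/-- The divided difference of the data `r` at the nodes `v i`, `i ∈ s`. -/
noncomputable def dividedDiff (v r : ℕ → ℝ) (s : Finset ℕ) : ℝ :=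
  (Lagrange.interpolate s v r).coeff (#s - 1)

theorem interpolate_eq_sub_nodal {v : ℕ → ℝ} (hv : Function.Injective v) (r : ℕ → ℝ)
    {s : Finset ℕ} {i : ℕ} (hi : i ∉ s) :
    Lagrange.interpolate s v r = Lagrange.interpolate (insert i s) v r -
      C (dividedDiff v r (insert i s)) * Lagrange.nodal s v := by
  symm
  apply Lagrange.eq_interpolate_of_eval_eq _ hv.injOn
  · rw [degree_lt_iff_coeff_zero]
    intro n hn
    have hdeg : (Lagrange.interpolate (insert i s) v r).degree < (#(insert i s) : ℕ) :=
      Lagrange.degree_interpolate_lt r hv.injOn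
    rw [card_insert_of_notMem hi] at hdeg
    rw [coeff_sub, coeff_C_mul]
    rcases hn.eq_or_lt with rfl | hn
    · have h1 : (Lagrange.nodal s v).coeff #s = 1 := by
        have h := Lagrange.nodal_monic (s := s) (v := v)
        rwa [Monic, leadingCoeff, Lagrange.natDegree_nodal] at h
      simp [dividedDiff, card_insert_of_notMem hi, h1]
    · rw [coeff_eq_zero_of_natDegree_lt (p := Lagrange.nodal s v)
        (by rwa [Lagrange.natDegree_nodal]),
        coeff_eq_zero_of_degree_lt (hdeg.trans_le (by exact_mod_cast hn))]
      simp
  · intro j hj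
    rw [eval_sub, eval_mul, Lagrange.eval_nodal_at_node hj,
      Lagrange.eval_interpolate_at_node r hv.injOn (mem_insert_of_mem hj)]
    simp

theorem dividedDiff_insert_sub_insert {v : ℕ → ℝ} (hv : Function.Injective v) (r : ℕ → ℝ)
    {s : Finset ℕ} {i j : ℕ} (hi : i ∉ s) (hj : j ∉ s) (hij : i ≠ j) :
    dividedDiff v r (insert i s) - dividedDiff v r (insert j s) =
      (v i - v j) * dividedDiff v r (insert i (insert j s)) := by
  have hi' : i ∉ insert j s := by simp [hi, hij]
  have hj' : j ∉ insert i s := by simp [hj, hij.symm]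
  have h1 := congrArg (fun p => p.coeff #s) (interpolate_eq_sub_nodal hv r hj')
  have h2 := congrArg (fun p => p.coeff #s) (interpolate_eq_sub_nodal hv r hi')
  have h3 : (Lagrange.nodal s v).coeff #s = 1 := by
    have h := Lagrange.nodal_monic (s := s) (v := v)
    rwa [Monic, leadingCoeff, Lagrange.natDegree_nodal] at h
  have h4 : (Lagrange.nodal (insert j s) v).coeff #s - (Lagrange.nodal (insert i s) v).coeff #s
      = v i - v j := by
    rw [← coeff_sub, Lagrange.nodal_insert_eq_nodal hj, Lagrange.nodal_insert_eq_nodal hi,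
      ← sub_mul, sub_sub_sub_cancel_left, ← C_sub, coeff_C_mul, h3, mul_one]
  rw [insert_comm j i s] at h1
  simp only [coeff_sub, coeff_C_mul] at h1 h2
  have e1 : dividedDiff v r (insert i s) =
      (Lagrange.interpolate (insert i s) v r).coeff #s := by
    simp [dividedDiff, card_insert_of_notMem hi]
  have e2 : dividedDiff v r (insert j s) =
      (Lagrange.interpolate (insert j s) v r).coeff #s := by
    simp [dividedDiff, card_insert_of_notMem hj]
  rw [e1, e2, h1, h2, ← h4]
  ring

theorem dividedDiff_eq_zero {v : ℕ → ℝ} (hv : Function.Injective v) {r : ℕ → ℝ}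
    {s : Finset ℕ} {p : ℝ[X]} (hp : p.degree < (#s - 1 : ℕ))
    (hr : ∀ i ∈ s, p.eval (v i) = r i) : dividedDiff v r s = 0 := by
  have h : p = Lagrange.interpolate s v r :=
    Lagrange.eq_interpolate_of_eval_eq r hv.injOn
      (hp.trans_le (by exact_mod_cast Nat.sub_le _ _)) hr
  rw [dividedDiff, ← h]
  exact coeff_eq_zero_of_degree_lt hp

/-- If all divided differences of order `n + 1` are positive, those of order `n` increase when
nodes are moved to the right. -/
theorem dividedDiff_le_of_forall_lt {v : ℕ → ℝ} (hv : StrictMono v) {r : ℕ → ℝ} {n : ℕ}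
    (hpos : ∀ s : Finset ℕ, #s = n + 2 → 0 < dividedDiff v r s) (A : Finset ℕ) :
    ∀ B D : Finset ℕ, #A = #B → #D + #A = n + 1 → Disjoint A D → Disjoint B D →
      (∀ a ∈ A, ∀ b ∈ B, b < a) →
      dividedDiff v r (D ∪ B) ≤ dividedDiff v r (D ∪ A) ∧
      (A.Nonempty → dividedDiff v r (D ∪ B) < dividedDiff v r (D ∪ A)) := by
  induction A using Finset.induction_on with
  | empty =>
    intro B D hB _ _ _ _
    obtain rfl : B = ∅ := by simpa using hB.symm
    simp
  | insert a A ha ih =>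
    intro B D hB hD hAD hBD hlt
    rw [card_insert_of_notMem ha] at hB hD
    obtain ⟨b, hb⟩ : B.Nonempty := card_pos.mp (by lia)
    obtain ⟨B, hbB, rfl⟩ : ∃ B', b ∉ B' ∧ B = insert b B' :=
      ⟨B.erase b, notMem_erase _ _, (insert_erase hb).symm⟩
    rw [card_insert_of_notMem hbB] at hB
    rw [disjoint_insert_left] at hAD hBD
    have hab : b < a := hlt a (mem_insert_self _ _) b (mem_insert_self _ _)
    have haB : a ∉ B := fun h => lt_irrefl a (hlt a (mem_insert_self _ _) a (mem_insert_of_mem h))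
    have hle := (ih B (insert a D) (by lia) (by rw [card_insert_of_notMem hAD.1]; lia)
      (disjoint_insert_right.mpr ⟨ha, hAD.2⟩) (disjoint_insert_right.mpr ⟨haB, hBD.2⟩)
      fun x hx y hy => hlt x (mem_insert_of_mem hx) y (mem_insert_of_mem hy)).1
    have haS : a ∉ D ∪ B := by simp [hAD.1, haB]
    have hbS : b ∉ D ∪ B := by simp [hBD.1, hbB]
    have hcard : #(insert a (insert b (D ∪ B))) = n + 2 := by
      rw [card_insert_of_notMem (by simp [hab.ne', hAD.1, haB]), card_insert_of_notMem hbS,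
        card_union_of_disjoint hBD.2.symm]
      lia
    have key := dividedDiff_insert_sub_insert hv.injective r haS hbS hab.ne'
    have hprod := mul_pos (sub_pos.mpr (hv hab)) (hpos _ hcard)
    rw [union_insert, union_insert, ← insert_union a D A]
    rw [insert_union] at hle
    exact ⟨by linarith, fun _ => by linarith⟩

/-- Rolle's theorem, iterated. -/
theorem exists_eq_zero_of_chain (n : ℕ) :
    ∀ (h : ℕ → ℝ → ℝ) (x : ℕ → ℝ), (∀ i < n + 1, x i < x (i + 1)) →
      ContinuousOn (h 0) (Set.Icc (x 0) (x (n + 1))) →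
      (∀ j, ∀ t ∈ Set.Ioo (x 0) (x (n + 1)), HasDerivAt (h j) (h (j + 1) t) t) →
      (∀ i ≤ n + 1, h 0 (x i) = 0) → ∃ t ∈ Set.Ioo (x 0) (x (n + 1)), h (n + 1) t = 0 := by
  induction n with
  | zero =>
    intro h x hx hc hd h0
    exact exists_hasDerivAt_eq_zero (hx 0 (by simp)) hc
      (by rw [h0 0 (by simp), h0 _ le_rfl]) (hd 0)
  | succ n ih =>
    intro h x hx hc hd h0
    have hmono : ∀ i j, i ≤ j → j ≤ n + 2 → x i ≤ x j := by
      intro i j hij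
      induction j, hij using Nat.le_induction with
      | base => intro _; exact le_rfl
      | succ j hij ihj => intro hj; exact (ihj (by lia)).trans (hx j (by lia)).le
    have hy : ∀ i, ∃ y, i < n + 2 → y ∈ Set.Ioo (x i) (x (i + 1)) ∧ h 1 y = 0 := by
      intro i
      by_cases hi : i < n + 2
      · have l1 := hmono 0 i (by lia) (by lia)
        have l2 := hmono (i + 1) (n + 2) (by lia) (by lia)
        obtain ⟨y, hy, hy0⟩ := exists_hasDerivAt_eq_zero (hx i hi)
          (hc.mono (Set.Icc_subset_Icc l1 l2)) (by rw [h0 i (by lia), h0 _ (by lia)])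
          (fun t ht => hd 0 t (Set.Ioo_subset_Ioo l1 l2 ht))
        exact ⟨y, fun _ => ⟨hy, hy0⟩⟩
      · exact ⟨0, fun h => absurd h hi⟩
    choose y hy using hy
    have hsub : Set.Icc (y 0) (y (n + 1)) ⊆ Set.Ioo (x 0) (x (n + 1 + 1)) := fun t ht =>
      ⟨(hy 0 (by lia)).1.1.trans_le ht.1, ht.2.trans_lt (hy (n + 1) (by lia)).1.2⟩
    obtain ⟨t, ht, ht0⟩ := ih (fun j => h (j + 1)) y
      (fun i hi => (hy i (by lia)).1.2.trans (hy (i + 1) (by lia)).1.1)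
      (fun t ht => (hd 1 t (hsub ht)).continuousAt.continuousWithinAt)
      (fun j t ht => hd (j + 1) t (hsub (Set.Ioo_subset_Icc_self ht)))
      (fun i hi => (hy i (by lia)).2)
    exact ⟨t, hsub (Set.Ioo_subset_Icc_self ht), ht0⟩

/-- The mean value theorem for divided differences, for a function on `[0, ∞)` which is smooth
on `(0, ∞)` with successive derivatives `h 0, h 1, …`. -/
theorem exists_factorial_mul_dividedDiff_eq {v : ℕ → ℝ} (hv : StrictMono v) (hv0 : 0 ≤ v 0)
    {h : ℕ → ℝ → ℝ} (hc : Continuous (h 0))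
    (hd : ∀ j, ∀ t > 0, HasDerivAt (h j) (h (j + 1) t) t) {n : ℕ} {s : Finset ℕ}
    (hs : #s = n + 2) :
    ∃ t > 0, ((n + 1).factorial : ℝ) * dividedDiff v (fun i => h 0 (v i)) s = h (n + 1) t := by
  set r : ℕ → ℝ := fun i => h 0 (v i) with hr
  set Q := Lagrange.interpolate s v r with hQ
  let e : ℕ → ℕ := fun i => if hi : i < n + 2 then s.orderEmbOfFin hs ⟨i, hi⟩ else 0
  have he : ∀ i, i < n + 2 → e i ∈ s := fun i hi => by
    simp only [e, hi, dif_pos]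
    exact orderEmbOfFin_mem _ _ _
  have hpos : ∀ i, 0 ≤ v i := fun i => hv0.trans (hv.monotone (Nat.zero_le i))
  obtain ⟨t, ht, ht0⟩ := exists_eq_zero_of_chain n
    (fun j t => h j t - (derivative^[j] Q).eval t) (fun i => v (e i))
    (by
      intro i hi
      apply hv
      have h1 : i < n + 2 := by lia
      have h2 : i + 1 < n + 2 := by lia
      simp only [e, h1, h2, dif_pos]
      simp)
    (by
      apply Continuous.continuousOn
      simp only [Function.iterate_zero, id]
      exact hc.sub Q.continuous)
    (by
      intro j t ht
      rw [Function.iterate_succ_apply']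
      exact (hd j t ((hpos _).trans_lt ht.1)).sub (Polynomial.hasDerivAt _ _))
    (by
      intro i hi
      simp only [Function.iterate_zero, id]
      rw [hQ, Lagrange.eval_interpolate_at_node r hv.injective.injOn (he i (by lia)), hr, sub_self])
  refine ⟨t, (hpos _).trans_lt ht.1, ?_⟩
  have hQd : Q.natDegree ≤ n + 1 := by
    have := Lagrange.degree_interpolate_le (s := s) r hv.injective.injOn
    rw [hs] at this
    exact natDegree_le_of_degree_le this
  have hC : derivative^[n + 1] Q = C ((derivative^[n + 1] Q).coeff 0) := by
    apply eq_C_of_natDegree_le_zero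
    have := natDegree_iterate_derivative Q (n + 1)
    lia
  rw [sub_eq_zero.mp ht0, hC, eval_C, coeff_iterate_derivative, zero_add, Nat.descFactorial_self, nsmul_eq_mul,
    dividedDiff, hs, ← hQ]
  rfl

/-- The `j`-th derivative of `x ↦ √x * p(x)` on the positive half-line. -/
noncomputable def sqrtMulDeriv (p : ℝ[X]) (j : ℕ) (x : ℝ) : ℝ :=
  ∑ k ∈ range (p.natDegree + 1),
    p.coeff k * (∏ i ∈ range j, ((k : ℝ) + 1 / 2 - i)) * x ^ ((k : ℝ) + 1 / 2 - j)

theorem hasDerivAt_sqrtMulDeriv (p : ℝ[X]) (j : ℕ) {x : ℝ} (hx : 0 < x) :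
    HasDerivAt (sqrtMulDeriv p j) (sqrtMulDeriv p (j + 1) x) x := by
  unfold sqrtMulDeriv
  refine HasDerivAt.fun_sum fun k _ => ?_
  have h := (Real.hasDerivAt_rpow_const (p := (k : ℝ) + 1 / 2 - j) (Or.inl hx.ne')).const_mul
    (p.coeff k * (∏ i ∈ range j, ((k : ℝ) + 1 / 2 - i)))
  refine h.congr_deriv ?_
  rw [prod_range_succ]
  push_cast
  rw [show (k : ℝ) + 1 / 2 - (j + 1) = k + 1 / 2 - j - 1 by ring]
  ring

theorem continuous_sqrtMulDeriv_zero (p : ℝ[X]) : Continuous (sqrtMulDeriv p 0) := by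
  unfold sqrtMulDeriv
  refine continuous_finsetSum _ fun k _ => continuous_const.mul ?_
  exact Real.continuous_rpow_const (by rw [Nat.cast_zero, sub_zero]; positivity)

theorem sqrtMulDeriv_zero_sq (p : ℝ[X]) {s : ℝ} (hs : 0 ≤ s) :
    sqrtMulDeriv p 0 (s ^ 2) = s * p.eval (s ^ 2) := by
  rw [sqrtMulDeriv, eval_eq_sum_range, mul_sum]
  refine sum_congr rfl fun k _ => ?_
  have : (s ^ 2) ^ ((k : ℝ) + 1 / 2 - (0 : ℕ)) = s * (s ^ 2) ^ k := by
    rw [← Real.rpow_natCast s 2, ← Real.rpow_mul hs,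
      show ((2 : ℕ) : ℝ) * ((k : ℝ) + 1 / 2 - (0 : ℕ)) = ((2 * k + 1 : ℕ) : ℝ) by push_cast; ring,
      Real.rpow_natCast, Real.rpow_natCast]
    ring
  rw [this]
  simp
  ring

theorem neg_one_pow_mul_prod_pos (k t : ℕ) :
    0 < (-1 : ℝ) ^ t * ∏ i ∈ range (k + 1 + t), ((k : ℝ) + 1 / 2 - i) := by
  induction t with
  | zero =>
    rw [pow_zero, one_mul]
    refine prod_pos fun i hi => ?_
    have : (i : ℝ) ≤ k := by exact_mod_cast Nat.lt_succ_iff.mp (mem_range.mp hi)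
    linarith
  | succ t ih =>
    rw [← add_assoc, prod_range_succ, pow_succ]
    have : 0 < -((k : ℝ) + 1 / 2 - (k + 1 + t : ℕ)) := by
      push_cast
      have : (0 : ℝ) ≤ t := t.cast_nonneg
      linarith
    have := mul_pos ih this
    linarith

/-- The monic polynomial with roots `1², 2², …, m²`. -/
noncomputable def squaresPoly (m : ℕ) : ℝ[X] :=
  ∏ k ∈ range m, (X - C (((k : ℝ) + 1) ^ 2))

theorem squaresPoly_monic (m : ℕ) : (squaresPoly m).Monic :=
  monic_prod_of_monic _ _ fun _ _ => monic_X_sub_C _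

theorem natDegree_squaresPoly (m : ℕ) : (squaresPoly m).natDegree = m := by
  rw [squaresPoly, natDegree_prod_of_monic _ _ fun _ _ => monic_X_sub_C _]
  simp only [natDegree_X_sub_C, sum_const, card_range, smul_eq_mul, mul_one]

theorem neg_one_pow_mul_coeff_squaresPoly_nonneg (m k : ℕ) :
    0 ≤ (-1 : ℝ) ^ (m + k) * (squaresPoly m).coeff k := by
  induction m generalizing k with
  | zero =>
    rcases k with _ | k
    · simp [squaresPoly]
    · simp [squaresPoly, coeff_one]
  | succ m ih =>
    have h : squaresPoly (m + 1) = squaresPoly m * (X - C (((m : ℝ) + 1) ^ 2)) := by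
      rw [squaresPoly, prod_range_succ, squaresPoly]
    rcases k with _ | k
    · rw [h, mul_coeff_zero]
      have := mul_nonneg (ih 0) (sq_nonneg ((m : ℝ) + 1))
      simp only [coeff_sub, coeff_X_zero, coeff_C_zero]
      rw [add_right_comm, pow_succ]
      linear_combination this
    · rw [h, coeff_mul_X_sub_C]
      have h1 := ih k
      have h2 := mul_nonneg (ih (k + 1)) (sq_nonneg ((m : ℝ) + 1))
      rw [show m + 1 + (k + 1) = m + k + 2 by ring]
      rw [show m + (k + 1) = m + k + 1 by ring] at h2
      rw [pow_succ] at h2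
      rw [pow_add]
      linarith

theorem sqrtMulDeriv_squaresPoly_pos (m : ℕ) {x : ℝ} (hx : 0 < x) :
    0 < sqrtMulDeriv (squaresPoly m) (m + 1) x := by
  have key : ∀ k ≤ m, (squaresPoly m).coeff k * (∏ i ∈ range (m + 1), ((k : ℝ) + 1 / 2 - i)) =
      ((-1 : ℝ) ^ (m + k) * (squaresPoly m).coeff k) *
        ((-1 : ℝ) ^ (m - k) * ∏ i ∈ range (k + 1 + (m - k)), ((k : ℝ) + 1 / 2 - i)) := by
    intro k hk
    obtain ⟨t, rfl⟩ := Nat.exists_eq_add_of_le hk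
    rw [show k + t - k = t by lia, show k + 1 + t = k + t + 1 by ring,
      show k + t + k = k + k + t by ring, pow_add, ← two_mul, pow_mul]
    have : (-1 : ℝ) ^ t * (-1) ^ t = 1 := by rw [← mul_pow]; simp
    linear_combination (-(squaresPoly (k + t)).coeff k *
      ∏ i ∈ range (k + t + 1), ((k : ℝ) + 1 / 2 - i)) * this
  rw [sqrtMulDeriv, natDegree_squaresPoly]
  refine sum_pos' (fun k hk => ?_) ⟨m, by simp, ?_⟩
  · rw [key k (by rw [mem_range] at hk; lia)]
    exact mul_nonneg (mul_nonneg (neg_one_pow_mul_coeff_squaresPoly_nonneg m k)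
      (neg_one_pow_mul_prod_pos k _).le) (Real.rpow_nonneg hx.le _)
  · have hm : (squaresPoly m).coeff m = 1 := by
      have h := squaresPoly_monic m
      rwa [Monic, leadingCoeff, natDegree_squaresPoly] at h
    have h := neg_one_pow_mul_prod_pos m 0
    rw [pow_zero, one_mul, add_zero] at h
    rw [hm, one_mul]
    exact mul_pos h (Real.rpow_pos_of_pos hx _)

theorem mul_eval_squaresPoly_of_le {m s : ℕ} (hs : s ≤ m) :
    (s : ℝ) * (squaresPoly m).eval ((s : ℝ) ^ 2) = 0 := by
  rcases s with _ | s
  · simp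
  · rw [squaresPoly, eval_prod, prod_eq_zero (mem_range.mpr (Nat.lt_of_succ_le hs))] <;> simp

theorem mul_eval_squaresPoly {m s : ℕ} (hs : m ≤ s) :
    (s : ℝ) * (squaresPoly m).eval ((s : ℝ) ^ 2) = ((s + m).descFactorial (2 * m + 1) : ℝ) := by
  induction m with
  | zero => simp [squaresPoly]
  | succ m ih =>
    have h : squaresPoly (m + 1) = squaresPoly m * (X - C (((m : ℝ) + 1) ^ 2)) := by
      rw [squaresPoly, prod_range_succ, squaresPoly]
    rw [h, eval_mul, ← mul_assoc, ih (by lia), show 2 * (m + 1) + 1 = 2 * m + 1 + 1 + 1 by ring,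
      ← add_assoc s m 1, Nat.succ_descFactorial_succ,
      Nat.descFactorial_succ _ (2 * m + 1),
      show s + m - (2 * m + 1) = s - (m + 1) by lia]
    rw [eval_sub, eval_X, eval_C]
    push_cast [Nat.cast_sub hs]
    ring

/-- The Lagrange interpolation polynomial `L_m` (of degree ≤ m-1) through
the points `(i(i-2m)/(2(2m+1)), C(i,2m+1))`, `i = 2m+1, …, 3m`, does not vanish at the
points `i(i-2m)/(2(2m+1))` for `0 ≤ i ≤ m`. -/
theorem stmt_2 (m : ℕ) (hm : 1 ≤ m) (L : Polynomial ℝ)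
    (hdeg : L.degree ≤ ((m - 1 : ℕ) : WithBot ℕ))
    (hinterp : ∀ i ∈ Finset.Icc (2 * m + 1) (3 * m),
      L.eval ((i : ℝ) * ((i : ℝ) - 2 * m) / (2 * (2 * m + 1)))
        = (Nat.choose i (2 * m + 1) : ℝ)) :
    ∀ i : ℕ, i ≤ m →
      L.eval ((i : ℝ) * ((i : ℝ) - 2 * m) / (2 * (2 * m + 1))) ≠ 0 := by
  intro i hi hzero
  set v : ℕ → ℝ := fun s => (s : ℝ) ^ 2 with hvdef
  have hv : StrictMono v := fun a b hab => by
    have : (a : ℝ) < b := by exact_mod_cast hab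
    simp only [hvdef]
    gcongr
  set r : ℕ → ℝ := fun s => sqrtMulDeriv (squaresPoly m) 0 (v s) with hrdef
  have hr : ∀ s : ℕ, r s = s * (squaresPoly m).eval ((s : ℝ) ^ 2) := fun s =>
    sqrtMulDeriv_zero_sq _ s.cast_nonneg
  have hpos : ∀ s : Finset ℕ, #s = m + 2 → 0 < dividedDiff v r s := by
    intro s hs
    obtain ⟨t, ht, h⟩ := exists_factorial_mul_dividedDiff_eq hv (by simp [hvdef])
      (continuous_sqrtMulDeriv_zero (squaresPoly m))
      (fun j t ht => hasDerivAt_sqrtMulDeriv _ j ht) hs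
    have h' := sqrtMulDeriv_squaresPoly_pos m ht
    rw [← h] at h'
    exact pos_of_mul_pos_right h' (Nat.cast_nonneg _)
  set A := Icc (m + 1) (2 * m) with hA
  set B := (range (m + 1)).erase (m - i) with hB
  have hcA : #A = m := by simp [hA]; lia
  have hcB : #B = m := by rw [hB, card_erase_of_mem (by simp), card_range, Nat.add_sub_cancel]
  have hAD : Disjoint A {m - i} := by simp [hA]
  have hBD : Disjoint B {m - i} := by simp [hB]
  have hlt := (dividedDiff_le_of_forall_lt hv hpos A B {m - i} (by lia) (by rw [card_singleton]; lia) hAD hBD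
    (fun a ha b hb => by
      simp only [hA, hB, mem_Icc, mem_erase, mem_range] at ha hb
      lia)).2 (card_pos.mp (by lia))
  have hzB : dividedDiff v r ({m - i} ∪ B) = 0 := by
    refine dividedDiff_eq_zero hv.injective (p := 0) (by simp) fun s hs => ?_
    rw [hr, mul_eval_squaresPoly_of_le, eval_zero]
    simp only [hB, mem_union, mem_singleton, mem_erase, mem_range] at hs
    lia
  have hzA : dividedDiff v r ({m - i} ∪ A) = 0 := by
    let q : ℝ[X] := C ((2 * (2 * (m : ℝ) + 1))⁻¹) * (X - C ((m : ℝ) ^ 2))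
    have hqe : ∀ x : ℝ, q.eval x = (x - m ^ 2) / (2 * (2 * m + 1)) := fun x => by
      simp [q, div_eq_inv_mul]
    refine dividedDiff_eq_zero hv.injective
      (p := C ((2 * m + 1).factorial : ℝ) * L.comp q) ?_ fun s hs => ?_
    · rw [card_union_of_disjoint hAD.symm, card_singleton, hcA, Nat.add_sub_cancel_left]
      have hq : q.natDegree ≤ 1 := by
        simp only [q]
        compute_degree
      have hL : L.natDegree ≤ m - 1 := natDegree_le_of_degree_le hdeg
      have h1 : (C ((2 * m + 1).factorial : ℝ) * L.comp q).natDegree ≤ m - 1 := by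
        refine (natDegree_C_mul_le _ _).trans (natDegree_comp_le.trans ?_)
        nlinarith
      exact (degree_le_of_natDegree_le h1).trans_lt (by exact_mod_cast (by lia : m - 1 < m))
    · rw [eval_mul, eval_C, eval_comp, hqe, hr]
      rw [mem_union, mem_singleton] at hs
      rcases hs with rfl | hs
      · rw [mul_eval_squaresPoly_of_le (Nat.sub_le _ _), hvdef]
        have : ((m - i : ℕ) : ℝ) ^ 2 - m ^ 2 = i * (i - 2 * m) := by
          rw [Nat.cast_sub hi]; ring
        simp only [this, hzero, mul_zero]
      · rw [hA, mem_Icc] at hs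
        obtain ⟨k, rfl⟩ := Nat.exists_eq_add_of_le (show m ≤ s by lia)
        rw [mul_eval_squaresPoly (by lia), Nat.descFactorial_eq_factorial_mul_choose,
          show m + k + m = 2 * m + k by ring, Nat.cast_mul, ← hinterp (2 * m + k) (by rw [mem_Icc]; lia), hvdef]
        congr 3
        push_cast
        ring
  rw [hzA, hzB] at hlt
  exact lt_irrefl _ hlt
end

section
/- Let m ≥ 1 be an integer. For every rational number t, ∑_{k=0}^{2m} (−1)^k C(2m,k) · Ch(t, 4m+1−k) · Ch(t, 2m+1+k) = B_m · ∏_{i=0}^{3m} ( t(t−2m)/(2(2m+1)) − h^{2i+1,1} ), where B_m = (−1)^m · C(2m,m) · (2(2m+1))^{3m+1} / ( C(4m+1,m) · ((3m+1)!)² ), C(n,k) is the ordinary binomial coefficient, Ch(x,r) the generalized binomial coefficient, and h^{2i+1,1} = i(i−2m)/(2(2m+1)). -/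
open Finset

/-- Generalized binomial coefficient `Ch(x,r) = x(x-1)⋯(x-r+1)/r!`. -/
def gch (x : ℚ) (r : ℕ) : ℚ :=
  (∏ j ∈ Finset.range r, (x - (j : ℚ))) / (Nat.factorial r : ℚ)

theorem succ_mul_gch_succ (x : ℚ) (n : ℕ) :
    ((n : ℚ) + 1) * gch x (n + 1) = (x - n) * gch x n := by
  have h : (n.factorial : ℚ) ≠ 0 := by exact_mod_cast n.factorial_ne_zero
  have h' : (n : ℚ) + 1 ≠ 0 := by positivity
  simp only [gch, Finset.prod_range_succ, Nat.factorial_succ]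
  push_cast
  field_simp

theorem gch_natCast_eq_zero {a n : ℕ} (h : a < n) : gch (a : ℚ) n = 0 := by
  rw [gch, Finset.prod_eq_zero (Finset.mem_range.2 h) (sub_self _), zero_div]

theorem sub_mul_gch_add_one (x : ℚ) (n : ℕ) :
    (x + 1 - n) * gch (x + 1) n = (x + 1) * gch x n := by
  have h : ∀ n : ℕ, (x + 1 - n) * ∏ j ∈ Finset.range n, (x + 1 - (j : ℚ))
      = (x + 1) * ∏ j ∈ Finset.range n, (x - (j : ℚ)) := by
    intro n
    induction n with
    | zero => simp
    | succ n ih =>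
      rw [Finset.prod_range_succ, Finset.prod_range_succ]
      push_cast
      linear_combination (x - n) * ih
  rw [gch, gch, mul_div_assoc', h, mul_div_assoc]

/-- The alternating sum of Dixon type `∑ (-1)^j C(2m,j) Ch(t,b+m-j) Ch(t,b+j-m)`. -/
def dixonSum (t : ℚ) (b m : ℕ) : ℚ :=
  ∑ j ∈ Finset.range (2 * m + 1),
    (-1 : ℚ) ^ j * (Nat.choose (2 * m) j : ℚ) * (gch t (b + m - j) * gch t (b + j - m))

theorem dixon_coeff (m i : ℕ) (b c : ℚ) :
    ((m : ℚ) + 1 + b) * (m + 1 + c) * (Nat.choose (2 * m + 2) (i + 1) : ℚ)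
        - 2 * (2 * m + 1) * (m + 1 + b + c) * (Nat.choose (2 * m) i : ℚ)
      = (b - (i - m)) * (c - (i - m)) * (Nat.choose (2 * m + 1) (i + 1) : ℚ)
        + (b + (i - m)) * (c + (i - m)) * (Nat.choose (2 * m + 1) i : ℚ) := by
  have h₁ : ((i : ℚ) + 1) * (Nat.choose (2 * m + 1) (i + 1) : ℚ)
      = (2 * m + 1) * (Nat.choose (2 * m) i : ℚ) := by
    have := Nat.add_one_mul_choose_eq (2 * m) i
    have h : (((2 * m + 1) * Nat.choose (2 * m) i : ℕ) : ℚ)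
      = ((Nat.choose (2 * m + 1) (i + 1) * (i + 1) : ℕ) : ℚ) := by rw [this]
    push_cast at h
    linear_combination -h
  have h₂ : (Nat.choose (2 * m + 2) (i + 1) : ℚ)
      = (Nat.choose (2 * m + 1) i : ℚ) + (Nat.choose (2 * m + 1) (i + 1) : ℚ) := by
    exact_mod_cast Nat.choose_succ_succ (2 * m + 1) i
  have h₃ : (2 * (m : ℚ) + 1 - i) * (Nat.choose (2 * m + 1) i : ℚ)
      = (2 * m + 1) * (Nat.choose (2 * m) i : ℚ) := by
    rcases Nat.lt_or_ge (2 * m + 1) i with h | h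
    · rw [Nat.choose_eq_zero_of_lt h, Nat.choose_eq_zero_of_lt (by omega : 2 * m < i)]
      simp
    · have := Nat.choose_mul_succ_eq (2 * m) i
      have h' : ((Nat.choose (2 * m) i * (2 * m + 1) : ℕ) : ℚ)
        = ((Nat.choose (2 * m + 1) i * (2 * m + 1 - i) : ℕ) : ℚ) := by rw [this]
      rw [Nat.cast_mul, Nat.cast_mul, Nat.cast_sub h] at h'
      push_cast at h'
      linear_combination -h'
  rw [h₂]
  linear_combination ((m : ℚ) + 1 + b + c + (i - m)) * h₃ + ((m : ℚ) + 1 + b + c - (i - m)) * h₁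

theorem gch_mul_gch_shift (t : ℚ) {b m i : ℕ} (hb : m + 1 ≤ b) (hi : i < 2 * m + 2) :
    ((b : ℚ) - (i - m - 1)) * (t - b - (i - m - 1))
        * (gch t (b + (m + 1) - i) * gch t (b + i - (m + 1)))
      = (b + (i - m)) * (t - b + (i - m))
        * (gch t (b + (m + 1) - (i + 1)) * gch t (b + (i + 1) - (m + 1))) := by
  obtain ⟨p, hp⟩ : ∃ p, b + (m + 1) - i = p + 1 := ⟨b + m - i, by omega⟩
  obtain ⟨q, hq⟩ : ∃ q, b + i - (m + 1) = q := ⟨_, rfl⟩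
  have hp' : b + (m + 1) - (i + 1) = p := by omega
  have hq' : b + (i + 1) - (m + 1) = q + 1 := by omega
  have hpc : (p : ℚ) = b + m - i := by
    have : p + i = b + m := by omega
    have : (p : ℚ) + i = b + m := by exact_mod_cast this
    linarith
  have hqc : (q : ℚ) = b + i - m - 1 := by
    have : q + m + 1 = b + i := by omega
    have : (q : ℚ) + m + 1 = b + i := by exact_mod_cast this
    linarith
  rw [hp, hq, hp', hq']
  have h₁ := succ_mul_gch_succ t p
  have h₂ := succ_mul_gch_succ t q
  rw [hpc] at h₁
  rw [hqc] at h₂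
  linear_combination (t - b - (i - m - 1)) * gch t q * h₁ - (t - b + (i - m)) * gch t p * h₂

theorem dixonSum_succ (t : ℚ) {b m : ℕ} (hb : m + 1 ≤ b) :
    ((m : ℚ) + 1 + b) * (m + 1 + (t - b)) * dixonSum t b (m + 1)
      = -(2 * (2 * m + 1) * (t + m + 1)) * dixonSum t b m := by
  set u : ℕ → ℚ := fun j => gch t (b + (m + 1) - j) * gch t (b + j - (m + 1)) with hu
  have e₁ : dixonSum t b (m + 1)
      = ∑ i ∈ Finset.range (2 * m + 2),
          (-1 : ℚ) ^ (i + 1) * (Nat.choose (2 * m + 2) (i + 1) : ℚ) * u (i + 1) + u 0 := by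
    rw [dixonSum, Finset.sum_range_succ']
    simp [hu, mul_add]
  have e₀ : dixonSum t b m
      = ∑ i ∈ Finset.range (2 * m + 2),
          (-1 : ℚ) ^ i * (Nat.choose (2 * m) i : ℚ) * u (i + 1) := by
    rw [Finset.sum_range_succ, Nat.choose_eq_zero_of_lt (Nat.lt_succ_self _), dixonSum]
    simp only [Nat.cast_zero, mul_zero, zero_mul, add_zero]
    refine Finset.sum_congr rfl fun j _ => ?_
    simp only [hu]
    rw [show b + (m + 1) - (j + 1) = b + m - j by omega,
      show b + (j + 1) - (m + 1) = b + j - m by omega]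
  let H : ℕ → ℚ := fun i => (-1 : ℚ) ^ i * (Nat.choose (2 * m + 1) i : ℚ)
    * ((b - (i - m - 1)) * (t - b - (i - m - 1)) * u i)
  have key : ∑ i ∈ Finset.range (2 * m + 2), (H (i + 1) - H i)
      = ((m : ℚ) + 1 + b) * (m + 1 + (t - b)) * ∑ i ∈ Finset.range (2 * m + 2),
          (-1 : ℚ) ^ (i + 1) * (Nat.choose (2 * m + 2) (i + 1) : ℚ) * u (i + 1)
        + 2 * (2 * m + 1) * (t + m + 1) * ∑ i ∈ Finset.range (2 * m + 2),
          (-1 : ℚ) ^ i * (Nat.choose (2 * m) i : ℚ) * u (i + 1) := by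
    rw [Finset.mul_sum, Finset.mul_sum, ← Finset.sum_add_distrib]
    refine Finset.sum_congr rfl fun i hi => ?_
    have h₁ := gch_mul_gch_shift t hb (Finset.mem_range.1 hi)
    have h₂ := dixon_coeff m i b (t - b)
    change _ * u i = _ * u (i + 1) at h₁
    simp only [H, pow_succ]
    push_cast
    linear_combination (-((-1 : ℚ) ^ i) * (Nat.choose (2 * m + 1) i : ℚ)) * h₁
      + (-1 : ℚ) ^ i * u (i + 1) * h₂
  rw [Finset.sum_range_sub] at key
  have hH : H (2 * m + 2) = 0 := by
    simp [H]
  have hH₀ : H 0 = ((m : ℚ) + 1 + b) * (m + 1 + (t - b)) * u 0 := by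
    simp only [H, pow_zero, Nat.choose_zero_right]
    push_cast
    ring
  rw [hH, hH₀] at key
  rw [e₁, e₀]
  linear_combination -key

theorem dixonSum_natCast_eq_zero {a b m : ℕ} (h : a < b) : dixonSum a b m = 0 := by
  refine Finset.sum_eq_zero fun j _ => ?_
  rcases le_total j m with hj | hj
  · rw [gch_natCast_eq_zero (by omega : a < b + m - j)]; simp
  · rw [gch_natCast_eq_zero (by omega : a < b + j - m)]; simp

theorem dixonSum_eq (t : ℚ) {b m : ℕ} (hb : m ≤ b) :
    (Nat.choose (m + b) m : ℚ) * dixonSum t b m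
      = (-1 : ℚ) ^ m * (Nat.choose (2 * m) m : ℚ) * (gch t b * gch (t + m) b) := by
  induction m with
  | zero => simp [dixonSum]
  | succ m ih =>
    by_cases ht : (m : ℚ) + 1 + (t - b) = 0
    · have ht' : t = ((b - (m + 1) : ℕ) : ℚ) := by
        rw [Nat.cast_sub hb]; push_cast; linarith
      have hlt : b - (m + 1) < b := by omega
      rw [ht', dixonSum_natCast_eq_zero hlt, gch_natCast_eq_zero hlt]
      simp
    · have ih' := ih (by omega)
      have hstep := dixonSum_succ t hb
      have hg := sub_mul_gch_add_one (t + m) b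
      have hc₁ : ((m : ℚ) + 1) * (Nat.choose (m + 1 + b) (m + 1) : ℚ)
          = (m + 1 + b) * (Nat.choose (m + b) m : ℚ) := by
        have := Nat.add_one_mul_choose_eq (m + b) m
        rw [show m + b + 1 = m + 1 + b by ring] at this
        have h : (((m + 1 + b) * Nat.choose (m + b) m : ℕ) : ℚ)
          = ((Nat.choose (m + 1 + b) (m + 1) * (m + 1) : ℕ) : ℚ) := by rw [this]
        push_cast at h
        linear_combination -h
      have hc₂ : ((m : ℚ) + 1) * (Nat.choose (2 * (m + 1)) (m + 1) : ℚ)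
          = 2 * (2 * m + 1) * (Nat.choose (2 * m) m : ℚ) := by
        exact_mod_cast Nat.succ_mul_centralBinom_succ m
      have hm : (m : ℚ) + 1 ≠ 0 := by positivity
      refine mul_left_cancel₀ (mul_ne_zero hm ht) ?_
      push_cast
      rw [pow_succ, ← add_assoc t]
      linear_combination ((m : ℚ) + 1 + (t - b)) * dixonSum t b (m + 1) * hc₁
        + (Nat.choose (m + b) m : ℚ) * hstep
        - (2 * (2 * m + 1) * (t + m + 1)) * ih'
        + (-1 : ℚ) ^ m * gch t b * gch (t + m + 1) b * ((m : ℚ) + 1 + (t - b)) * hc₂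
        + (-1 : ℚ) ^ m * gch t b * 2 * (2 * m + 1) * (Nat.choose (2 * m) m : ℚ) * hg

theorem prod_eq_gch_mul_gch (m : ℕ) (t : ℚ) :
    (2 * (2 * m + 1) : ℚ) ^ (3 * m + 1) * ∏ i ∈ Finset.range (3 * m + 1),
        (t * (t - 2 * m) / (2 * (2 * m + 1))
          - (i : ℚ) * ((i : ℚ) - 2 * m) / (2 * (2 * m + 1)))
      = ((3 * m + 1).factorial : ℚ) ^ 2 * (gch t (3 * m + 1) * gch (t + m) (3 * m + 1)) := by
  have h : ((3 * m + 1).factorial : ℚ) ≠ 0 := by exact_mod_cast Nat.factorial_ne_zero _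
  have hr : ∏ i ∈ Finset.range (3 * m + 1), (t + m - (i : ℚ))
      = ∏ i ∈ Finset.range (3 * m + 1), (t + i - 2 * m) := by
    rw [← Finset.prod_range_reflect]
    refine Finset.prod_congr rfl fun i hi => ?_
    have hi' := Finset.mem_range.1 hi
    rw [show 3 * m + 1 - 1 - i = 3 * m - i by omega, Nat.cast_sub (by omega)]
    push_cast
    ring
  have hp : (2 * (2 * m + 1) : ℚ) ^ (3 * m + 1)
      = ∏ _i ∈ Finset.range (3 * m + 1), (2 * (2 * m + 1) : ℚ) := by simp
  have hd : (2 * m + 1 : ℚ) ≠ 0 := by positivity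
  rw [hp, ← Finset.prod_mul_distrib, gch, gch, hr]
  field_simp
  rw [← Finset.prod_mul_distrib]
  refine Finset.prod_congr rfl fun i _ => ?_
  field_simp
  ring

/-- the identity
`∑_{k=0}^{2m} (−1)^k C(2m,k) Ch(t,4m+1−k) Ch(t,2m+1+k)
  = B_m ∏_{i=0}^{3m} (t(t−2m)/(2(2m+1)) − h^{2i+1,1})` with
`B_m = (−1)^m C(2m,m) (2(2m+1))^{3m+1} / (C(4m+1,m) ((3m+1)!)²)` and
`h^{2i+1,1} = i(i−2m)/(2(2m+1))`. -/
theorem stmt_8 (m : ℕ) (hm : 1 ≤ m) (t : ℚ) :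
    ∑ k ∈ Finset.range (2 * m + 1),
        (-1 : ℚ) ^ k * (Nat.choose (2 * m) k : ℚ)
          * gch t (4 * m + 1 - k) * gch t (2 * m + 1 + k)
      = ((-1 : ℚ) ^ m * (Nat.choose (2 * m) m : ℚ) * (2 * (2 * m + 1) : ℚ) ^ (3 * m + 1)
            / ((Nat.choose (4 * m + 1) m : ℚ) * (Nat.factorial (3 * m + 1) : ℚ) ^ 2))
          * ∏ i ∈ Finset.range (3 * m + 1),
              (t * (t - 2 * m) / (2 * (2 * m + 1))
                - (i : ℚ) * ((i : ℚ) - 2 * m) / (2 * (2 * m + 1))) := by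
  have hs : ∑ k ∈ Finset.range (2 * m + 1), (-1 : ℚ) ^ k * (Nat.choose (2 * m) k : ℚ)
      * gch t (4 * m + 1 - k) * gch t (2 * m + 1 + k) = dixonSum t (3 * m + 1) m := by
    refine Finset.sum_congr rfl fun k _ => ?_
    rw [show 3 * m + 1 + m - k = 4 * m + 1 - k by omega,
      show 3 * m + 1 + k - m = 2 * m + 1 + k by omega, mul_assoc _ (gch t _)]
  have hD := dixonSum_eq t (b := 3 * m + 1) (m := m) (by omega)
  rw [show m + (3 * m + 1) = 4 * m + 1 by ring] at hD
  have hc : (Nat.choose (4 * m + 1) m : ℚ) ≠ 0 := by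
    exact_mod_cast (Nat.choose_pos (by omega)).ne'
  have hf : ((3 * m + 1).factorial : ℚ) ≠ 0 := by exact_mod_cast Nat.factorial_ne_zero _
  rw [hs, div_mul_eq_mul_div, eq_div_iff (mul_ne_zero hc (pow_ne_zero 2 hf))]
  linear_combination ((3 * m + 1).factorial : ℚ) ^ 2 * hD
    - (-1 : ℚ) ^ m * (Nat.choose (2 * m) m : ℚ) * prod_eq_gch_mul_gch m t
end

section
/- For every complex number y with |y| < 1, ( ∑_{n∈ℤ} (3n+1) · y^{(3n+1)²} ) · ∏_{n=1}^{∞} (1 + y^{6n−3})² = y · ∏_{n=1}^{∞} (1 − y^{6n})³, where the sum over ℤ and the infinite products converge absolutely. (With q = y^6, this is the theta identity (∂Θ)_{1,3/2}(τ) = η(τ)³ / 𝔣(τ)², where η(τ) = q^{1/24}∏_{n≥1}(1−q^n), 𝔣(τ) = q^{−1/48}∏_{n≥1}(1+q^{n−1/2}), and (∂Θ)_{1,3/2}(τ) = ∑_{n∈ℤ}(3n+1)q^{(3n+1)²/6}.) -/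
open Filter Topology Finset

/-- The finite `q`-Pochhammer symbol `(q; q)_n`. -/
noncomputable def qPoch (q : ℂ) (n : ℕ) : ℂ := ∏ i ∈ range n, (1 - q ^ (i + 1))

/-- Gaussian binomial coefficients, by the `q`-Pascal recursion. -/
noncomputable def gaussBinom (q : ℂ) : ℕ → ℕ → ℂ
  | _, 0 => 1
  | 0, _ + 1 => 0
  | M + 1, j + 1 => gaussBinom q M (j + 1) + q ^ (M - j) * gaussBinom q M j

theorem gaussBinom_zero_right (q : ℂ) (M : ℕ) : gaussBinom q M 0 = 1 := by
  cases M <;> simp [gaussBinom]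

theorem gaussBinom_eq_zero_of_lt (q : ℂ) {M j : ℕ} (h : M < j) : gaussBinom q M j = 0 := by
  induction M generalizing j with
  | zero => obtain ⟨j, rfl⟩ := Nat.exists_eq_succ_of_ne_zero h.ne'; simp [gaussBinom]
  | succ M ih =>
    obtain ⟨j, rfl⟩ := Nat.exists_eq_succ_of_ne_zero (Nat.ne_zero_of_lt h)
    simp [gaussBinom, ih (show M < j + 1 by omega), ih (show M < j by omega)]

theorem gaussBinom_add_mul_qPoch (q : ℂ) (a b : ℕ) :
    gaussBinom q (a + b) a * (qPoch q a * qPoch q b) = qPoch q (a + b) := by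
  obtain ⟨n, hn⟩ : ∃ n, a + b = n := ⟨_, rfl⟩
  induction n generalizing a b with
  | zero =>
    obtain ⟨rfl, rfl⟩ : a = 0 ∧ b = 0 := by omega
    simp [gaussBinom, qPoch]
  | succ n ih =>
    rcases a with _ | a
    · simp [gaussBinom_zero_right, qPoch]
    rcases b with _ | b
    · have h := ih a 0 (by omega)
      simp only [add_zero] at h ⊢
      rw [gaussBinom, gaussBinom_eq_zero_of_lt q (Nat.lt_succ_self a)]
      simp only [qPoch, prod_range_succ, Nat.sub_self] at h ⊢
      linear_combination (1 - q ^ (a + 1)) * h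
    · have h1 := ih a (b + 1) (by omega)
      have h2 := ih (a + 1) b (by omega)
      rw [show a + 1 + b = a + b + 1 by ring] at h2
      rw [show a + (b + 1) = a + b + 1 by ring] at h1
      rw [show a + 1 + (b + 1) = a + b + 1 + 1 by ring, gaussBinom,
        show a + b + 1 - a = b + 1 by omega]
      simp only [qPoch, prod_range_succ] at h1 h2 ⊢
      have e : q ^ (a + b + 1 + 1) = q ^ (a + 1) * q ^ (b + 1) := by ring
      rw [e]
      linear_combination (1 - q ^ (b + 1)) * h2 + q ^ (b + 1) * (1 - q ^ (a + 1)) * h1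

/-- The `q`-binomial theorem. -/
theorem prod_one_add_mul_pow_eq_sum (q x : ℂ) (M : ℕ) :
    ∏ k ∈ range M, (1 + x * q ^ k)
      = ∑ j ∈ range (M + 1), gaussBinom q M j * q ^ (j.choose 2) * x ^ j := by
  induction M with
  | zero => simp [gaussBinom]
  | succ M ih =>
    rw [prod_range_succ, ih, sum_range_succ' _ (M + 1)]
    have h : ∀ j ∈ range (M + 1),
        gaussBinom q (M + 1) (j + 1) * q ^ ((j + 1).choose 2) * x ^ (j + 1)
        = gaussBinom q M (j + 1) * q ^ ((j + 1).choose 2) * x ^ (j + 1)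
          + gaussBinom q M j * q ^ (j.choose 2) * x ^ j * (x * q ^ M) := by
      intro j hj
      obtain ⟨d, rfl⟩ := Nat.exists_eq_add_of_le (Nat.lt_succ_iff.1 (mem_range.1 hj))
      rw [gaussBinom, Nat.choose_succ_succ' j 1, Nat.choose_one_right, Nat.add_sub_cancel_left]
      ring
    rw [sum_congr rfl h, sum_add_distrib, ← sum_mul,
      sum_range_succ (fun j => gaussBinom q M (j + 1) * q ^ ((j + 1).choose 2) * x ^ (j + 1)),
      gaussBinom_eq_zero_of_lt q (Nat.lt_succ_self M),
      sum_range_succ' _ M]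
    simp [gaussBinom_zero_right]
    ring

theorem summable_norm_pow_mul_add {q : ℂ} (hq : ‖q‖ < 1) {a : ℕ} (ha : 0 < a) (b : ℕ) :
    Summable fun n : ℕ => ‖q ^ (a * n + b)‖ := by
  simp_rw [norm_pow, pow_add, pow_mul]
  exact (summable_geometric_of_lt_one (by positivity)
    (pow_lt_one₀ (norm_nonneg _) hq ha.ne')).mul_right _

theorem multipliable_one_sub_pow {q : ℂ} (hq : ‖q‖ < 1) :
    Multipliable fun n : ℕ => 1 - q ^ (n + 1) := by
  have := summable_norm_pow_mul_add hq one_pos 1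
  simpa [sub_eq_add_neg] using multipliable_one_add_of_summable (f := fun n : ℕ => -q ^ (n + 1))
    (by simpa using this)

theorem one_sub_pow_ne_zero {q : ℂ} (hq : ‖q‖ < 1) (n : ℕ) : 1 - q ^ (n + 1) ≠ 0 := by
  intro h
  have : ‖q ^ (n + 1)‖ < 1 := by
    rw [norm_pow]; exact pow_lt_one₀ (norm_nonneg _) hq n.succ_ne_zero
  rw [← sub_eq_zero.1 h] at this
  simp at this

theorem tprod_one_sub_pow_ne_zero {q : ℂ} (hq : ‖q‖ < 1) : ∏' n : ℕ, (1 - q ^ (n + 1)) ≠ 0 := by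
  have := summable_norm_pow_mul_add hq one_pos 1
  simpa [sub_eq_add_neg] using tprod_one_add_ne_zero_of_summable (f := fun n : ℕ => -q ^ (n + 1))
    (fun n => by simpa [sub_eq_add_neg] using one_sub_pow_ne_zero hq n) (by simpa using this)

theorem qPoch_ne_zero {q : ℂ} (hq : ‖q‖ < 1) (n : ℕ) : qPoch q n ≠ 0 :=
  prod_ne_zero_iff.2 fun i _ => one_sub_pow_ne_zero hq i

theorem tendsto_qPoch {q : ℂ} (hq : ‖q‖ < 1) :
    Tendsto (qPoch q) atTop (𝓝 (∏' n : ℕ, (1 - q ^ (n + 1)))) :=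
  (multipliable_one_sub_pow hq).hasProd.tendsto_prod_nat

theorem gaussBinom_add_eq_div {q : ℂ} (hq : ‖q‖ < 1) (a b : ℕ) :
    gaussBinom q (a + b) a = qPoch q (a + b) * (qPoch q a)⁻¹ * (qPoch q b)⁻¹ := by
  have := gaussBinom_add_mul_qPoch q a b
  have ha := qPoch_ne_zero hq a
  have hb := qPoch_ne_zero hq b
  field_simp
  linear_combination this

theorem exists_norm_gaussBinom_le {q : ℂ} (hq : ‖q‖ < 1) :
    ∃ C, ∀ M j, ‖gaussBinom q M j‖ ≤ C := by
  have h1 := tendsto_qPoch hq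
  obtain ⟨A, hA⟩ := (Metric.isBounded_range_of_tendsto _ h1).exists_norm_le
  obtain ⟨B, hB⟩ := (Metric.isBounded_range_of_tendsto _
    (h1.inv₀ (tprod_one_sub_pow_ne_zero hq))).exists_norm_le
  have hA' : ∀ n, ‖qPoch q n‖ ≤ A := fun n => hA _ ⟨n, rfl⟩
  have hB' : ∀ n, ‖(qPoch q n)⁻¹‖ ≤ B := fun n => hB _ ⟨n, rfl⟩
  have hA0 : 0 ≤ A := (norm_nonneg _).trans (hA' 0)
  have hB0 : 0 ≤ B := (norm_nonneg _).trans (hB' 0)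
  refine ⟨A * B * B, fun M j => ?_⟩
  rcases lt_or_ge M j with h | h
  · rw [gaussBinom_eq_zero_of_lt q h, norm_zero]; positivity
  · obtain ⟨b, rfl⟩ := Nat.exists_eq_add_of_le h
    rw [gaussBinom_add_eq_div hq, norm_mul, norm_mul]
    gcongr <;> simp only [hA', hB']

/-- Tannery's theorem for sums weighted by central Gaussian binomial coefficients. -/
theorem tendsto_sum_gaussBinom_mul {q : ℂ} (hq : ‖q‖ < 1) {c : ℤ → ℂ}
    (hc : Summable fun n => ‖c n‖) :
    Tendsto (fun N : ℕ => ∑ j ∈ range (2 * N + 1), gaussBinom q (2 * N) j * c ((j : ℤ) - N)) atTop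
      (𝓝 ((∏' n : ℕ, (1 - q ^ (n + 1)))⁻¹ * ∑' n, c n)) := by
  set Q := ∏' n : ℕ, (1 - q ^ (n + 1)) with hQ
  have hQ0 : Q ≠ 0 := tprod_one_sub_pow_ne_zero hq
  obtain ⟨C, hC⟩ := exists_norm_gaussBinom_le hq
  have hC0 : 0 ≤ C := (norm_nonneg _).trans (hC 0 0)
  let g : ℕ → ℤ → ℂ := fun N n =>
    if 0 ≤ n + N then gaussBinom q (2 * N) (n + N).toNat * c n else 0
  have hg : ∀ N : ℕ, ∑ j ∈ range (2 * N + 1), gaussBinom q (2 * N) j * c ((j : ℤ) - N)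
      = ∑' n, g N n := by
    intro N
    have hinj : Function.Injective fun j : ℕ => (j : ℤ) - N := fun a b h => by
      simpa using h
    rw [← hinj.tsum_eq (f := g N), tsum_eq_sum (s := range (2 * N + 1))]
    · exact sum_congr rfl fun j _ => by simp [g]
    · intro j hj
      simp only [mem_range, not_lt] at hj
      simp [g, gaussBinom_eq_zero_of_lt q (show 2 * N < j by omega)]
    · intro n hn
      have : 0 ≤ n + N := by
        by_contra h
        exact hn (if_neg h)
      exact ⟨(n + N).toNat, by simp [Int.toNat_of_nonneg this]⟩
  simp_rw [hg, ← tsum_mul_left]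
  refine tendsto_tsum_of_dominated_convergence (hc.mul_left C) (fun n => ?_)
    (Eventually.of_forall fun N n => ?_)
  · have ht : Tendsto (fun N : ℕ => qPoch q (2 * N) * (qPoch q (n + N).toNat)⁻¹
        * (qPoch q ((N : ℤ) - n).toNat)⁻¹ * c n) atTop (𝓝 (Q * Q⁻¹ * Q⁻¹ * c n)) := by
      have hP := tendsto_qPoch hq
      have hI := hP.inv₀ hQ0
      refine (((hP.comp ?_).mul (hI.comp ?_)).mul (hI.comp ?_)).mul_const _
      · exact tendsto_atTop_mono (fun N => by simp only [id]; omega) tendsto_id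
      · exact tendsto_atTop.2 fun b => (eventually_ge_atTop (b + n.natAbs)).mono
          fun N hN => by omega
      · exact tendsto_atTop.2 fun b => (eventually_ge_atTop (b + n.natAbs)).mono
          fun N hN => by omega
    rw [mul_inv_cancel₀ hQ0, one_mul] at ht
    refine ht.congr' ((eventually_ge_atTop n.natAbs).mono fun N hN => ?_)
    have h0 : 0 ≤ n + N := by omega
    simp only [g, if_pos h0]
    have hab : (n + N).toNat + ((N : ℤ) - n).toNat = 2 * N := by omega
    rw [← hab, gaussBinom_add_eq_div hq]
  · simp only [g]
    split_ifs
    · rw [norm_mul]; gcongr; exact hC _ _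
    · rw [norm_zero]; positivity

/-- The finite form of the Jacobi triple product identity. -/
theorem prod_one_add_mul_one_add_inv_eq_sum {s z : ℂ} (hs : s ≠ 0) (hz : z ≠ 0) (N : ℕ) :
    ∏ k ∈ range N, ((1 + z * s ^ (2 * k + 1)) * (1 + z⁻¹ * s ^ (2 * k + 1)))
      = ∑ j ∈ range (2 * N + 1), gaussBinom (s ^ 2) (2 * N) j
        * (s ^ (((j : ℤ) - N) ^ 2) * z ^ ((j : ℤ) - N)) := by
  have h1 := prod_one_add_mul_pow_eq_sum (s ^ 2) (z * s ^ (1 - 2 * N : ℤ)) (2 * N)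
  have h2 : ∏ k ∈ range (2 * N), (1 + z * s ^ (1 - 2 * N : ℤ) * (s ^ 2) ^ k)
      = z ^ N * s ^ (-(N : ℤ) ^ 2) *
        ∏ k ∈ range N, ((1 + z * s ^ (2 * k + 1)) * (1 + z⁻¹ * s ^ (2 * k + 1))) := by
    have h3 : ∏ k ∈ range N, (z * s ^ (-(2 * k + 1) : ℤ)) = z ^ N * s ^ (-(N : ℤ) ^ 2) := by
      clear h1
      induction N with
      | zero => simp
      | succ N ih =>
        rw [prod_range_succ, ih, pow_succ, show (-((N + 1 : ℕ) : ℤ) ^ 2)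
          = -(N : ℤ) ^ 2 + (-(2 * N + 1)) by push_cast; ring, zpow_add₀ hs]
        ring_nf
    rw [two_mul, prod_range_add, ← prod_range_reflect, ← h3, ← prod_mul_distrib,
      ← prod_mul_distrib]
    refine prod_congr rfl fun k hk => ?_
    have hk := mem_range.1 hk
    have e1 : s ^ (1 - 2 * N : ℤ) * (s ^ 2) ^ (N - 1 - k) = s ^ (-(2 * k + 1) : ℤ) := by
      rw [← pow_mul, ← zpow_natCast, ← zpow_add₀ hs]
      congr 1
      zify [show k ≤ N - 1 by omega, show 1 ≤ N by omega]
      ring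
    have e2 : s ^ (1 - 2 * N : ℤ) * (s ^ 2) ^ (N + k) = s ^ (2 * k + 1) := by
      rw [← pow_mul, ← zpow_natCast, ← zpow_add₀ hs, ← zpow_natCast]
      congr 1
      push_cast
      ring
    have e3 : s ^ (-(2 * k + 1) : ℤ) * s ^ (2 * k + 1) = 1 := by
      rw [← zpow_natCast, ← zpow_add₀ hs]
      simp
    rw [mul_assoc, mul_assoc, e1, e2]
    linear_combination (-(1 + z * s ^ (2 * k + 1)))
      * (e3 + s ^ (-(2 * k + 1) : ℤ) * s ^ (2 * k + 1) * mul_inv_cancel₀ hz)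
  rw [h2] at h1
  have h4 : z ^ N * s ^ (-(N : ℤ) ^ 2) ≠ 0 :=
    mul_ne_zero (pow_ne_zero _ hz) (zpow_ne_zero _ hs)
  refine mul_left_cancel₀ h4 (h1.trans ?_)
  rw [mul_sum]
  refine sum_congr rfl fun j _ => ?_
  have hc : (2 * j.choose 2 : ℤ) = j * (j - 1) := by
    have := Nat.choose_two_right j
    have h5 := Nat.div_mul_cancel (Nat.even_mul_pred_self j).two_dvd
    rw [← this] at h5
    rcases j with _ | j
    · simp
    · simp only [Nat.add_sub_cancel] at h5
      push_cast at *
      zify at h5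
      linarith
  have e1 : (s ^ 2) ^ j.choose 2 * (s ^ (1 - 2 * N : ℤ)) ^ j
      = s ^ (-(N : ℤ) ^ 2) * s ^ (((j : ℤ) - N) ^ 2) := by
    rw [← pow_mul, ← zpow_natCast, ← zpow_natCast, ← zpow_mul, ← zpow_add₀ hs, ← zpow_add₀ hs]
    congr 1
    push_cast
    rw [hc]
    ring
  have e2 : z ^ j = z ^ N * z ^ ((j : ℤ) - N) := by
    rw [← zpow_natCast, ← zpow_natCast, ← zpow_add₀ hz]
    simp
  rw [mul_pow, e2]
  linear_combination gaussBinom (s ^ 2) (2 * N) j * z ^ N * z ^ ((j : ℤ) - N) * e1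

theorem summable_norm_intCast_pow_mul_zpow {t : ℂ} (ht0 : t ≠ 0) (ht : ‖t‖ < 1) (k : ℕ) {a : ℤ}
    (ha : 0 < a) (b c : ℤ) :
    Summable fun n : ℤ => ‖(n : ℂ) ^ k * t ^ (a * n ^ 2 + b * n + c)‖ := by
  have hr : 0 < ‖t‖ := norm_pos_iff.2 ht0
  have hlog : Real.log ‖t‖ < 0 := Real.log_neg hr ht
  set l := -Real.log ‖t‖ with hl
  have hlpos : 0 < l := by linarith
  have hpi := Real.pi_pos
  have hT : 0 < a * l / Real.pi := by
    have : (0 : ℝ) < a := by exact_mod_cast ha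
    positivity
  have := (summable_pow_mul_jacobiTheta₂_term_bound (|(b : ℝ)| * l / (2 * Real.pi)) hT k).mul_right
    (‖t‖ ^ c)
  refine Summable.of_nonneg_of_le (fun _ => norm_nonneg _) (fun n => ?_) this
  rw [norm_mul, norm_pow, norm_zpow, Complex.norm_intCast, zpow_add₀ hr.ne', ← mul_assoc,
    Int.cast_abs]
  gcongr
  rw [← Real.rpow_intCast, Real.rpow_def_of_pos hr]
  refine Real.exp_le_exp.2 ?_
  have e : -Real.pi * (a * l / Real.pi * (n : ℝ) ^ 2
      - 2 * (|(b : ℝ)| * l / (2 * Real.pi)) * |(n : ℝ)|)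
      = l * (|(b : ℝ) * n| - a * (n : ℝ) ^ 2) := by
    rw [abs_mul]
    field_simp
    ring
  rw [e, show Real.log ‖t‖ = -l by simp [hl]]
  push_cast
  have h3 := neg_abs_le ((b : ℝ) * n)
  nlinarith

theorem tendsto_finite_triple_product {s z : ℂ} (hs : s ≠ 0) (hs1 : ‖s‖ < 1) (hz : z ≠ 0)
    (hc : Summable fun n : ℤ => ‖s ^ (n ^ 2) * z ^ n‖) :
    Tendsto (fun N : ℕ =>
        ∏ k ∈ range N, ((1 + z * s ^ (2 * k + 1)) * (1 + z⁻¹ * s ^ (2 * k + 1)))) atTop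
      (𝓝 ((∏' n : ℕ, (1 - (s ^ 2) ^ (n + 1)))⁻¹ * ∑' n : ℤ, s ^ (n ^ 2) * z ^ n)) := by
  simp_rw [prod_one_add_mul_one_add_inv_eq_sum hs hz]
  refine tendsto_sum_gaussBinom_mul (c := fun n : ℤ => s ^ (n ^ 2) * z ^ n) ?_ hc
  rw [norm_pow]
  exact pow_lt_one₀ (norm_nonneg _) hs1 two_ne_zero

/-- Gauss's product for `∑ t ^ n ^ 2`. -/
theorem tsum_zpow_sq {t : ℂ} (ht0 : t ≠ 0) (ht : ‖t‖ < 1) :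
    ∑' n : ℤ, t ^ (n ^ 2)
      = (∏' n : ℕ, (1 - (t ^ 2) ^ (n + 1))) * (∏' n : ℕ, (1 + t ^ (2 * n + 1)) ^ 2) := by
  have hq : ‖t ^ 2‖ < 1 := by
    rw [norm_pow]; exact pow_lt_one₀ (norm_nonneg _) ht two_ne_zero
  have h1 := tendsto_finite_triple_product ht0 ht one_ne_zero
    (by simpa using summable_norm_intCast_pow_mul_zpow ht0 ht 0 one_pos 0 0)
  have h2 : Multipliable fun n : ℕ => (1 + t ^ (2 * n + 1)) ^ 2 :=
    (multipliable_one_add_of_summable (summable_norm_pow_mul_add ht two_pos 1)).pow 2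
  have h3 := tendsto_nhds_unique h1 (h2.hasProd.tendsto_prod_nat.congr fun N =>
    prod_congr rfl fun k _ => by rw [inv_one]; ring)
  rw [← h3, mul_inv_cancel_left₀ (tprod_one_sub_pow_ne_zero hq)]
  simp

/-- Euler's pentagonal number theorem, in the variable `t ^ 2`. -/
theorem tsum_pentagonal {t : ℂ} (ht0 : t ≠ 0) (ht : ‖t‖ < 1) :
    ∑' n : ℤ, (-1) ^ n * t ^ (3 * n ^ 2 + n) = ∏' n : ℕ, (1 - (t ^ 2) ^ (n + 1)) := by
  have hq : ‖t ^ 2‖ < 1 := by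
    rw [norm_pow]; exact pow_lt_one₀ (norm_nonneg _) ht two_ne_zero
  have hs : ‖t ^ 3‖ < 1 := by
    rw [norm_pow]; exact pow_lt_one₀ (norm_nonneg _) ht three_ne_zero
  have hs2 : ‖(t ^ 3) ^ 2‖ < 1 := by
    rw [norm_pow]; exact pow_lt_one₀ (norm_nonneg _) hs two_ne_zero
  have hterm : ∀ n : ℤ, (t ^ 3) ^ (n ^ 2) * (-t) ^ n = (-1) ^ n * t ^ (3 * n ^ 2 + n) := by
    intro n
    rw [neg_eq_neg_one_mul t, mul_zpow, zpow_add₀ ht0, zpow_mul t 3, zpow_ofNat]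
    ring
  have h1 := tendsto_finite_triple_product (pow_ne_zero 3 ht0) hs (neg_ne_zero.2 ht0) (by
    simp_rw [hterm]
    simpa using summable_norm_intCast_pow_mul_zpow ht0 ht 0 three_pos 1 0)
  simp_rw [hterm] at h1
  have h2 : ∀ N, (∏ k ∈ range N, ((1 + -t * (t ^ 3) ^ (2 * k + 1))
      * (1 + (-t)⁻¹ * (t ^ 3) ^ (2 * k + 1)))) * qPoch ((t ^ 3) ^ 2) N = qPoch (t ^ 2) (3 * N) := by
    intro N
    induction N with
    | zero => simp [qPoch]
    | succ N ih =>
      rw [prod_range_succ, Nat.mul_succ]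
      simp only [qPoch, prod_range_succ] at ih ⊢
      rw [← ih]
      have e : (-t)⁻¹ * (t ^ 3) ^ (2 * N + 1) = - t ^ (6 * N + 2) := by
        field_simp
        ring
      rw [e]
      ring
  have h3 := tendsto_nhds_unique ((h1.mul (tendsto_qPoch hs2)).congr h2)
    ((tendsto_qPoch hq).comp (tendsto_atTop_mono (fun N => by simp only [id]; omega) tendsto_id :
      Tendsto (fun N => 3 * N) atTop atTop))
  rwa [mul_right_comm, inv_mul_cancel₀ (tprod_one_sub_pow_ne_zero hs2), one_mul] at h3

/-- Jacobi's identity for the cube of the Euler product, in the variable `t ^ 2`. -/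
theorem tsum_jacobi_cube {t : ℂ} (ht0 : t ≠ 0) (ht : ‖t‖ < 1) :
    ∑' n : ℤ, (n : ℂ) * (-1) ^ n * t ^ (n ^ 2 + n) = (∏' n : ℕ, (1 - (t ^ 2) ^ (n + 1))) ^ 3 := by
  have hq : ‖t ^ 2‖ < 1 := by
    rw [norm_pow]; exact pow_lt_one₀ (norm_nonneg _) ht two_ne_zero
  have h1 : ∀ N : ℕ, ∑ j ∈ range (2 * (N + 1) + 1), gaussBinom (t ^ 2) (2 * (N + 1)) j
      * ((((j : ℤ) - (N + 1 : ℕ) : ℤ) : ℂ) * (-1) ^ ((j : ℤ) - (N + 1 : ℕ))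
        * t ^ (((j : ℤ) - (N + 1 : ℕ)) ^ 2 + ((j : ℤ) - (N + 1 : ℕ))))
      = qPoch (t ^ 2) (N + 1) * qPoch (t ^ 2) N := by
    intro N
    let R : ℂ → ℂ := fun w => (∏ k ∈ range (N + 1), (1 - w * t ^ (2 * k + 2)))
      * ∏ k ∈ range N, (1 - w⁻¹ * t ^ (2 * k + 2))
    have hfin : ∀ w : ℂ, w ≠ 0 → (1 - w⁻¹) * R w
        = ∑ j ∈ range (2 * (N + 1) + 1), gaussBinom (t ^ 2) (2 * (N + 1)) j
        * ((-1) ^ ((j : ℤ) - (N + 1 : ℕ))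
        * t ^ (((j : ℤ) - (N + 1 : ℕ)) ^ 2 + ((j : ℤ) - (N + 1 : ℕ)))
          * w ^ ((j : ℤ) - (N + 1 : ℕ))) := by
      intro w hw
      have h := prod_one_add_mul_one_add_inv_eq_sum ht0
        (neg_ne_zero.2 (mul_ne_zero ht0 hw)) (N + 1)
      rw [prod_mul_distrib, prod_range_succ' (fun k => 1 + (-(t * w))⁻¹ * t ^ (2 * k + 1))] at h
      have e0 : 1 + (-(t * w))⁻¹ * t ^ (2 * 0 + 1) = 1 - w⁻¹ := by
        field_simp
        ring
      have e1 : ∀ k, 1 + (-(t * w))⁻¹ * t ^ (2 * (k + 1) + 1) = 1 - w⁻¹ * t ^ (2 * k + 2) := by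
        intro k
        field_simp
        ring
      have e2 : ∀ k, 1 + -(t * w) * t ^ (2 * k + 1) = 1 - w * t ^ (2 * k + 2) := by
        intro k
        ring
      simp_rw [e0, e1, e2] at h
      rw [mul_comm, mul_assoc, h]
      refine sum_congr rfl fun j _ => ?_
      rw [neg_eq_neg_one_mul (t * w), mul_zpow, mul_zpow, zpow_add₀ ht0]
      ring
    have hR : DifferentiableAt ℂ R 1 := by
      have : (1 : ℂ) ≠ 0 := one_ne_zero
      fun_prop (disch := assumption)
    have hL : HasDerivAt (fun w => (1 - w⁻¹) * R w) (R 1) 1 := by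
      have := ((hasDerivAt_inv (one_ne_zero (α := ℂ))).const_sub 1).fun_mul hR.hasDerivAt
      simpa using this
    have hS : HasDerivAt (fun w : ℂ => ∑ j ∈ range (2 * (N + 1) + 1),
        gaussBinom (t ^ 2) (2 * (N + 1)) j
        * ((-1) ^ ((j : ℤ) - (N + 1 : ℕ))
        * t ^ (((j : ℤ) - (N + 1 : ℕ)) ^ 2 + ((j : ℤ) - (N + 1 : ℕ)))
          * w ^ ((j : ℤ) - (N + 1 : ℕ)))) _ 1 :=
      HasDerivAt.fun_sum fun j _ =>
        ((hasDerivAt_zpow _ 1 (Or.inl one_ne_zero)).const_mul _).const_mul _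
    have hE := hL.unique (hS.congr_of_eventuallyEq
      ((eventually_ne_nhds one_ne_zero).mono hfin))
    have hR1 : R 1 = qPoch (t ^ 2) (N + 1) * qPoch (t ^ 2) N := by
      simp only [R, qPoch, one_mul, inv_one, ← pow_mul, mul_add, mul_one]
    rw [← hR1, hE]
    refine sum_congr rfl fun j _ => ?_
    rw [one_zpow]
    ring
  have hc : Summable fun n : ℤ => ‖(n : ℂ) * (-1) ^ n * t ^ (n ^ 2 + n)‖ := by
    simpa using summable_norm_intCast_pow_mul_zpow ht0 ht 1 one_pos 1 0
  have hP := tendsto_qPoch hq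
  have h2 := tendsto_nhds_unique
    (((tendsto_sum_gaussBinom_mul hq hc).comp (tendsto_add_atTop_nat 1)).congr h1)
    ((hP.comp (tendsto_add_atTop_nat 1)).mul hP)
  have := tprod_one_sub_pow_ne_zero hq
  field_simp at h2
  linear_combination h2

theorem tsum_eq_add_of_isCompl_range {β γ : Type*} {i j : β → γ} {F : γ → ℂ} (hF : Summable F)
    (hi : Function.Injective i) (hj : Function.Injective j)
    (hij : IsCompl (Set.range i) (Set.range j)) :
    ∑' x, F x = ∑' b, F (i b) + ∑' b, F (j b) :=
  ((hi.hasSum_range_iff.2 (hF.comp_injective hi).hasSum).add_isCompl hij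
    (hj.hasSum_range_iff.2 (hF.comp_injective hj).hasSum)).tsum_eq

theorem tsum_eq_zero_of_equiv_neg {β : Type*} (e : β ≃ β) {F : β → ℂ} (h : ∀ b, F (e b) = -F b) :
    ∑' b, F b = 0 := by
  have := e.tsum_eq F
  simp_rw [h, tsum_neg] at this
  exact self_eq_neg.1 this.symm

/-- The sum `∑ α q ^ N(α)` over Eisenstein integers, computed in two ways. -/
theorem tsum_theta_mul_tsum_sq {t : ℂ} (ht0 : t ≠ 0) (ht : ‖t‖ < 1) :
    (∑' n : ℤ, ((3 * n + 1 : ℤ) : ℂ) * t ^ (3 * n ^ 2 + 2 * n)) * ∑' n : ℤ, t ^ (n ^ 2)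
      = (∑' n : ℤ, (n : ℂ) * (-1) ^ n * t ^ (n ^ 2 + n))
        * ∑' n : ℤ, (-1) ^ n * t ^ (3 * n ^ 2 + n) := by
  have s0 : ∀ {a : ℤ} (_ : 0 < a) (b : ℤ), Summable fun n : ℤ => ‖t ^ (a * n ^ 2 + b * n)‖ :=
    fun ha b => by simpa using summable_norm_intCast_pow_mul_zpow ht0 ht 0 ha b 0
  have s1 : ∀ {a : ℤ} (_ : 0 < a) (b : ℤ),
      Summable fun n : ℤ => ‖(n : ℂ) * t ^ (a * n ^ 2 + b * n)‖ :=
    fun ha b => by simpa using summable_norm_intCast_pow_mul_zpow ht0 ht 1 ha b 0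
  have hA : Summable fun n : ℤ => ‖((3 * n + 1 : ℤ) : ℂ) * t ^ (3 * n ^ 2 + 2 * n)‖ := by
    refine Summable.of_nonneg_of_le (fun _ => norm_nonneg _) (fun n => ?_)
      (((s1 three_pos 2).mul_left 3).add (s0 three_pos 2))
    calc _ = ‖3 * ((n : ℂ) * t ^ (3 * n ^ 2 + 2 * n)) + t ^ (3 * n ^ 2 + 2 * n)‖ := by
          push_cast; ring_nf
      _ ≤ _ := (norm_add_le _ _).trans (by rw [norm_mul]; simp)
  have hB : Summable fun n : ℤ => ‖t ^ (n ^ 2)‖ := by simpa using s0 one_pos 0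
  have hC : Summable fun n : ℤ => ‖(n : ℂ) * (-1) ^ n * t ^ (n ^ 2 + n)‖ := by
    simpa using s1 one_pos 1
  have hD : Summable fun n : ℤ => ‖(-1 : ℂ) ^ n * t ^ (3 * n ^ 2 + n)‖ := by
    simpa using s0 three_pos 1
  rw [tsum_mul_tsum_of_summable_norm hA hB, tsum_mul_tsum_of_summable_norm hC hD]
  have hAB := summable_mul_of_summable_norm hA hB
  have hCD := summable_mul_of_summable_norm hC hD
  let i₁ : ℤ × ℤ → ℤ × ℤ := fun p => (p.1, 2 * p.2 - p.1)
  let i₂ : ℤ × ℤ → ℤ × ℤ := fun p => (p.1, 2 * p.2 - p.1 + 1)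
  let j₁ : ℤ × ℤ → ℤ × ℤ := fun p => (2 * p.1 - p.2, p.2)
  let j₂ : ℤ × ℤ → ℤ × ℤ := fun p => (p.2 - 2 * p.1 - 1, p.2)
  have hi₁ : Function.Injective i₁ := by
    rintro ⟨a, b⟩ ⟨c, d⟩ h
    simp only [i₁, Prod.mk.injEq] at h ⊢
    omega
  have hi₂ : Function.Injective i₂ := by
    rintro ⟨a, b⟩ ⟨c, d⟩ h
    simp only [i₂, Prod.mk.injEq] at h ⊢
    omega
  have hj₁ : Function.Injective j₁ := by
    rintro ⟨a, b⟩ ⟨c, d⟩ h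
    simp only [j₁, Prod.mk.injEq] at h ⊢
    omega
  have hj₂ : Function.Injective j₂ := by
    rintro ⟨a, b⟩ ⟨c, d⟩ h
    simp only [j₂, Prod.mk.injEq] at h ⊢
    omega
  have hi : IsCompl (Set.range i₁) (Set.range i₂) := by
    refine ⟨Set.disjoint_left.2 ?_, codisjoint_iff.2 (Set.eq_univ_of_forall ?_)⟩
    · rintro _ ⟨⟨a, b⟩, rfl⟩ ⟨⟨c, d⟩, h⟩
      simp only [i₁, i₂, Prod.mk.injEq] at h
      omega
    · rintro ⟨a, b⟩
      rcases Int.even_or_odd' (a + b) with ⟨k, h | h⟩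
      · exact Or.inl ⟨(a, k), Prod.ext rfl (by simp only [i₁]; omega)⟩
      · exact Or.inr ⟨(a, k), Prod.ext rfl (by simp only [i₂]; omega)⟩
  have hj : IsCompl (Set.range j₁) (Set.range j₂) := by
    refine ⟨Set.disjoint_left.2 ?_, codisjoint_iff.2 (Set.eq_univ_of_forall ?_)⟩
    · rintro _ ⟨⟨a, b⟩, rfl⟩ ⟨⟨c, d⟩, h⟩
      simp only [j₁, j₂, Prod.mk.injEq] at h
      omega
    · rintro ⟨a, b⟩
      rcases Int.even_or_odd' (a + b) with ⟨k, h | h⟩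
      · exact Or.inl ⟨(k, b), Prod.ext (by simp only [j₁]; omega) rfl⟩
      · exact Or.inr ⟨(b - k - 1, b), Prod.ext (by simp only [j₂]; omega) rfl⟩
  have sA₁ := hAB.comp_injective hi₁
  have sA₂ := hAB.comp_injective hi₂
  have sC₁ := hCD.comp_injective hj₁
  have sC₂ := hCD.comp_injective hj₂
  rw [tsum_eq_add_of_isCompl_range hAB hi₁ hi₂ hi, tsum_eq_add_of_isCompl_range hCD hj₁ hj₂ hj]
  have hA₁ : ∀ p, ((3 * (i₁ p).1 + 1 : ℤ) : ℂ) * t ^ (3 * (i₁ p).1 ^ 2 + 2 * (i₁ p).1)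
      * t ^ ((i₁ p).2 ^ 2)
      = (3 * p.1 + 1) * t ^ (4 * p.1 ^ 2 + 2 * p.1 + 4 * p.2 ^ 2 - 4 * p.2 * p.1) := by
    intro p
    rw [mul_assoc, ← zpow_add₀ ht0]
    simp only [i₁]
    push_cast
    ring_nf
  have hA₂ : ∀ p, ((3 * (i₂ p).1 + 1 : ℤ) : ℂ) * t ^ (3 * (i₂ p).1 ^ 2 + 2 * (i₂ p).1)
      * t ^ ((i₂ p).2 ^ 2)
      = (3 * p.1 + 1) * t ^ (4 * p.1 ^ 2 + 4 * p.2 ^ 2 - 4 * p.2 * p.1 + 4 * p.2 + 1) := by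
    intro p
    rw [mul_assoc, ← zpow_add₀ ht0]
    simp only [i₂]
    push_cast
    ring_nf
  have hC₁ : ∀ p, ((j₁ p).1 : ℂ) * (-1) ^ (j₁ p).1 * t ^ ((j₁ p).1 ^ 2 + (j₁ p).1)
      * ((-1) ^ (j₁ p).2 * t ^ (3 * (j₁ p).2 ^ 2 + (j₁ p).2))
      = (2 * p.1 - p.2) * t ^ (4 * p.1 ^ 2 + 2 * p.1 + 4 * p.2 ^ 2 - 4 * p.2 * p.1) := by
    intro p
    have hs : (-1 : ℂ) ^ (2 * p.1 - p.2) * (-1) ^ p.2 = 1 := by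
      rw [← zpow_add₀ (by norm_num)]
      exact Even.neg_one_zpow ⟨p.1, by ring⟩
    have ht : t ^ ((2 * p.1 - p.2) ^ 2 + (2 * p.1 - p.2)) * t ^ (3 * p.2 ^ 2 + p.2)
        = t ^ (4 * p.1 ^ 2 + 2 * p.1 + 4 * p.2 ^ 2 - 4 * p.2 * p.1) := by
      rw [← zpow_add₀ ht0]
      ring_nf
    simp only [j₁]
    rw [← ht]
    push_cast
    linear_combination (2 * p.1 - p.2 : ℂ) * (t ^ ((2 * p.1 - p.2) ^ 2 + (2 * p.1 - p.2))
      * t ^ (3 * p.2 ^ 2 + p.2)) * hs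
  have hC₂ : ∀ p, ((j₂ p).1 : ℂ) * (-1) ^ (j₂ p).1 * t ^ ((j₂ p).1 ^ 2 + (j₂ p).1)
      * ((-1) ^ (j₂ p).2 * t ^ (3 * (j₂ p).2 ^ 2 + (j₂ p).2))
      = (2 * p.1 - p.2 + 1) * t ^ (4 * p.1 ^ 2 + 2 * p.1 + 4 * p.2 ^ 2 - 4 * p.2 * p.1) := by
    intro p
    have hs : (-1 : ℂ) ^ (p.2 - 2 * p.1 - 1) * (-1) ^ p.2 = -1 := by
      rw [← zpow_add₀ (by norm_num)]
      exact Odd.neg_one_zpow ⟨p.2 - p.1 - 1, by ring⟩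
    have ht : t ^ ((p.2 - 2 * p.1 - 1) ^ 2 + (p.2 - 2 * p.1 - 1)) * t ^ (3 * p.2 ^ 2 + p.2)
        = t ^ (4 * p.1 ^ 2 + 2 * p.1 + 4 * p.2 ^ 2 - 4 * p.2 * p.1) := by
      rw [← zpow_add₀ ht0]
      ring_nf
    simp only [j₂]
    rw [← ht]
    push_cast
    linear_combination (p.2 - 2 * p.1 - 1 : ℂ)
      * (t ^ ((p.2 - 2 * p.1 - 1) ^ 2 + (p.2 - 2 * p.1 - 1)) * t ^ (3 * p.2 ^ 2 + p.2)) * hs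
  simp only [Function.comp_def, hA₁, hA₂, hC₁, hC₂] at sA₁ sA₂ sC₁ sC₂ ⊢
  have hodd : ∑' p : ℤ × ℤ, (3 * p.1 + 1 : ℂ)
      * t ^ (4 * p.1 ^ 2 + 4 * p.2 ^ 2 - 4 * p.2 * p.1 + 4 * p.2 + 1) = 0 := by
    let r : ℤ × ℤ ≃ ℤ × ℤ :=
      { toFun := fun p => (-p.2 - 1, p.1 - p.2 - 1)
        invFun := fun p => (p.2 - p.1, -p.1 - 1)
        left_inv := fun p => Prod.ext (by ring) (by ring)
        right_inv := fun p => Prod.ext (by ring) (by ring) }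
    let c : ℤ × ℤ ≃ ℤ × ℤ :=
      { toFun := fun p => (p.1, p.1 - 1 - p.2)
        invFun := fun p => (p.1, p.1 - 1 - p.2)
        left_inv := fun p => Prod.ext (by ring) (by ring)
        right_inv := fun p => Prod.ext (by ring) (by ring) }
    have h1 := r.tsum_eq fun p : ℤ × ℤ => (3 * p.1 + 1 : ℂ)
      * t ^ (4 * p.1 ^ 2 + 4 * p.2 ^ 2 - 4 * p.2 * p.1 + 4 * p.2 + 1)
    have h2 := sA₂.tsum_add (((r.summable_iff).2 sA₂).mul_left 2)
    rw [tsum_eq_zero_of_equiv_neg c, tsum_mul_left] at h2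
    · simp only [Function.comp_def, h1] at h2
      linear_combination (-1 / 3 : ℂ) * h2
    · intro p
      simp only [Function.comp_def, r, c, Equiv.coe_fn_mk]
      push_cast
      ring_nf
  let c : ℤ × ℤ ≃ ℤ × ℤ :=
    { toFun := fun p => (p.1, p.1 - p.2)
      invFun := fun p => (p.1, p.1 - p.2)
      left_inv := fun p => Prod.ext (by ring) (by ring)
      right_inv := fun p => Prod.ext (by ring) (by ring) }
  rw [hodd, add_zero, ← sC₁.tsum_add sC₂, ← sub_eq_zero, ← sA₁.tsum_sub (sC₁.add sC₂)]
  refine tsum_eq_zero_of_equiv_neg c fun p => ?_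
  simp only [c, Equiv.coe_fn_mk]
  push_cast
  ring_nf

/-- for `|y| < 1`,
`(∑_{n∈ℤ} (3n+1) y^{(3n+1)²}) ∏_{n≥1} (1+y^{6n-3})² = y ∏_{n≥1} (1-y^{6n})³`,
with the series and products converging absolutely. -/
theorem stmt_13 (y : ℂ) (hy : ‖y‖ < 1) :
    Summable (fun n : ℤ => ((3 * n + 1 : ℤ) : ℂ) * y ^ ((3 * n + 1) ^ 2))
      ∧ Multipliable (fun n : ℕ => (1 + y ^ (6 * n + 3)) ^ 2)
      ∧ Multipliable (fun n : ℕ => (1 - y ^ (6 * n + 6)) ^ 3)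
      ∧ (∑' n : ℤ, ((3 * n + 1 : ℤ) : ℂ) * y ^ ((3 * n + 1) ^ 2))
          * (∏' n : ℕ, (1 + y ^ (6 * n + 3)) ^ 2)
        = y * ∏' n : ℕ, (1 - y ^ (6 * n + 6)) ^ 3 := by
  have hm1 : Multipliable (fun n : ℕ => (1 + y ^ (6 * n + 3)) ^ 2) :=
    (multipliable_one_add_of_summable
      (summable_norm_pow_mul_add hy (by norm_num : 0 < 6) 3)).pow 2
  have hm2 : Multipliable (fun n : ℕ => 1 - y ^ (6 * n + 6)) := by
    simpa [sub_eq_add_neg] using multipliable_one_add_of_summable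
      (f := fun n : ℕ => -y ^ (6 * n + 6))
      (by simpa using summable_norm_pow_mul_add hy (by norm_num : 0 < 6) 6)
  rcases eq_or_ne y 0 with rfl | hy0
  · have h0 : ∀ n : ℤ, ((3 * n + 1 : ℤ) : ℂ) * (0 : ℂ) ^ ((3 * n + 1) ^ 2) = 0 := fun n => by
      rw [zero_zpow _ (pow_ne_zero 2 (by omega)), mul_zero]
    refine ⟨by simp_rw [h0]; exact summable_zero, hm1, hm2.pow 3, ?_⟩
    simp_rw [h0]
    simp
  have ht0 : y ^ 3 ≠ 0 := pow_ne_zero 3 hy0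
  have ht : ‖y ^ 3‖ < 1 := by
    rw [norm_pow]; exact pow_lt_one₀ (norm_nonneg _) hy three_ne_zero
  have hq : ‖(y ^ 3) ^ 2‖ < 1 := by
    rw [norm_pow]; exact pow_lt_one₀ (norm_nonneg _) ht two_ne_zero
  have hsum : Summable (fun n : ℤ => ((3 * n + 1 : ℤ) : ℂ) * y ^ ((3 * n + 1) ^ 2)) := by
    have s0 := summable_norm_intCast_pow_mul_zpow hy0 hy 0 (by norm_num : (0 : ℤ) < 9) 6 1
    have s1 := summable_norm_intCast_pow_mul_zpow hy0 hy 1 (by norm_num : (0 : ℤ) < 9) 6 1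
    refine ((s1.of_norm.mul_left 3).add s0.of_norm).congr fun n => ?_
    rw [show (3 * n + 1) ^ 2 = 9 * n ^ 2 + 6 * n + 1 by ring]
    push_cast
    ring
  refine ⟨hsum, hm1, hm2.pow 3, ?_⟩
  have hy3 : ∀ n : ℤ, ((3 * n + 1 : ℤ) : ℂ) * y ^ ((3 * n + 1) ^ 2)
      = y * (((3 * n + 1 : ℤ) : ℂ) * (y ^ 3) ^ (3 * n ^ 2 + 2 * n)) := by
    intro n
    rw [show (3 * n + 1) ^ 2 = 3 * (3 * n ^ 2 + 2 * n) + 1 by ring, zpow_add₀ hy0, zpow_mul y 3,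
      zpow_ofNat, zpow_one]
    ring
  have key := tsum_theta_mul_tsum_sq ht0 ht
  rw [tsum_zpow_sq ht0 ht, tsum_pentagonal ht0 ht, tsum_jacobi_cube ht0 ht] at key
  have hP := tprod_one_sub_pow_ne_zero hq
  have e1 : ∀ n : ℕ, 1 - y ^ (6 * n + 6) = 1 - ((y ^ 3) ^ 2) ^ (n + 1) := fun n => by ring
  have e2 : ∀ n : ℕ, y ^ (6 * n + 3) = (y ^ 3) ^ (2 * n + 1) := fun n => by ring
  rw [hm2.tprod_pow]
  simp_rw [hy3, tsum_mul_left, e1, e2]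
  refine mul_left_cancel₀ hP ?_
  linear_combination y * key
end
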